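/- arXiv:1609.00482 — 5 statements merged into one kernel-verified Lean document; each statement's English description precedes it below -/
import Mathlib

section
/- Let Ω be the 4×4 complex matrix indexed by Fin 2 × Fin 2 with entries Ω_{(a,b),(c,d)} = (1/2)·δ_{a b}·δ_{c d} (the maximally entangled two-qubit state), and let ρ' = (1/3) Σ_{i=1}^{3} (σ_i ⊗ I₂) Ω (σ_i ⊗ I₂), where σ₁, σ₂, σ₃ are the Pauli matrices. Then Ω and ρ' are density matrices and F_α(Ω, ρ') = 0 for every α ∈ (0,1). -/
open Matrix
open scoped Kronecker ComplexOrder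

/-- Real power of a (Hermitian) matrix, defined by applying the real power function to the
eigenvalues via the spectral decomposition (functional calculus). -/
noncomputable def mpow {ι : Type*} [Fintype ι] [DecidableEq ι]
    (A : Matrix ι ι ℂ) (t : ℝ) : Matrix ι ι ℂ :=
  if hA : A.IsHermitian then
    (hA.eigenvectorUnitary : Matrix ι ι ℂ) *
      Matrix.diagonal (fun i => ((hA.eigenvalues i ^ t : ℝ) : ℂ)) *
      star (hA.eigenvectorUnitary : Matrix ι ι ℂ)
  else 0

/-- The α-fidelity `F_α(ρ,σ) = tr[(σ^((1−α)/(2α)) ρ σ^((1−α)/(2α)))^α]`. -/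
noncomputable def aFid {ι : Type*} [Fintype ι] [DecidableEq ι]
    (α : ℝ) (ρ σ : Matrix ι ι ℂ) : ℝ :=
  (Matrix.trace (mpow (mpow σ ((1 - α) / (2 * α)) * ρ * mpow σ ((1 - α) / (2 * α))) α)).re

/-- A density matrix: positive semidefinite with trace 1. -/
def IsDensity {ι : Type*} [Fintype ι] (ρ : Matrix ι ι ℂ) : Prop :=
  ρ.PosSemidef ∧ ρ.trace = 1

/-- Partial trace over the second tensor factor. -/
noncomputable def ptrace2 {ι κ : Type*} [Fintype κ]
    (M : Matrix (ι × κ) (ι × κ) ℂ) : Matrix ι ι ℂ :=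
  Matrix.of fun i j => ∑ k : κ, M (i, k) (j, k)

/-- A quantum channel: a map admitting a Kraus representation `E(X) = Σ_i K_i X K_i*`
with `Σ_i K_i* K_i = 1`. -/
def IsQChannel {ι κ : Type*} [Fintype ι] [DecidableEq ι] [Fintype κ] [DecidableEq κ]
    (E : Matrix ι ι ℂ → Matrix κ κ ℂ) : Prop :=
  ∃ (k : ℕ) (K : Fin k → Matrix κ ι ℂ),
    (∀ X, E X = ∑ i, K i * X * (K i)ᴴ) ∧ (∑ i, (K i)ᴴ * K i = 1)

/-- The α-fidelity of channels:
`𝓕_α(E₁,E₂) = inf { F_α(E₁(ρ₁),E₂(ρ₂)) / F_α(ρ₁,ρ₂) }` over density matrices with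
`F_α(ρ₁,ρ₂) > 0`. -/
noncomputable def chanFid {ι κ : Type*} [Fintype ι] [DecidableEq ι] [Fintype κ] [DecidableEq κ]
    (α : ℝ) (E₁ E₂ : Matrix ι ι ℂ → Matrix κ κ ℂ) : ℝ :=
  sInf { r : ℝ | ∃ ρ₁ ρ₂ : Matrix ι ι ℂ, IsDensity ρ₁ ∧ IsDensity ρ₂ ∧
    0 < aFid α ρ₁ ρ₂ ∧ r = aFid α (E₁ ρ₁) (E₂ ρ₂) / aFid α ρ₁ ρ₂ }

/-- The maximally entangled two-qubit state `Ω`, with entries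
`Ω_{(a,b),(c,d)} = (1/2) δ_{ab} δ_{cd}`. -/
noncomputable def Omega : Matrix (Fin 2 × Fin 2) (Fin 2 × Fin 2) ℂ :=
  Matrix.of fun p q =>
    (1 / 2 : ℂ) * (if p.1 = p.2 then 1 else 0) * (if q.1 = q.2 then 1 else 0)

/-- The three Pauli matrices. -/
noncomputable def pauli : Fin 3 → Matrix (Fin 2) (Fin 2) ℂ :=
  ![!![0, 1; 1, 0], !![0, -Complex.I; Complex.I, 0], !![1, 0; 0, -1]]

/-- `ρ' = (1/3) Σ_{i=1}^{3} (σ_i ⊗ I₂) Ω (σ_i ⊗ I₂)`. -/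
noncomputable def rhoPrime : Matrix (Fin 2 × Fin 2) (Fin 2 × Fin 2) ℂ :=
  (1 / 3 : ℂ) • ∑ i : Fin 3,
    (pauli i ⊗ₖ (1 : Matrix (Fin 2) (Fin 2) ℂ)) * Omega *
      (pauli i ⊗ₖ (1 : Matrix (Fin 2) (Fin 2) ℂ))

/-- A nonzero real power of a matrix annihilates everything that the matrix annihilates. -/
theorem mpow_mul_eq_zero {ι : Type*} [Fintype ι] [DecidableEq ι] {A M : Matrix ι ι ℂ} {t : ℝ}
    (ht : t ≠ 0) (h : A * M = 0) : mpow A t * M = 0 := by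
  unfold mpow
  split_ifs with hA
  · have hU : star (hA.eigenvectorUnitary : Matrix ι ι ℂ) *
        (hA.eigenvectorUnitary : Matrix ι ι ℂ) = 1 := Unitary.coe_star_mul_self _
    have hD : diagonal (fun i => (hA.eigenvalues i : ℂ)) *
        (star (hA.eigenvectorUnitary : Matrix ι ι ℂ) * M) = 0 := by
      have hspec : A = (hA.eigenvectorUnitary : Matrix ι ι ℂ) *
          diagonal (fun i => (hA.eigenvalues i : ℂ)) *
          star (hA.eigenvectorUnitary : Matrix ι ι ℂ) := hA.spectral_theorem
      calc _ = star (hA.eigenvectorUnitary : Matrix ι ι ℂ) *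
            (((hA.eigenvectorUnitary : Matrix ι ι ℂ) *
              diagonal (fun i => (hA.eigenvalues i : ℂ)) *
              star (hA.eigenvectorUnitary : Matrix ι ι ℂ)) * M) := by
              simp only [Matrix.mul_assoc]
              rw [← Matrix.mul_assoc (star _) (hA.eigenvectorUnitary : Matrix ι ι ℂ), hU,
                Matrix.one_mul]
        _ = 0 := by rw [← hspec, h, Matrix.mul_zero]
    rw [Matrix.mul_assoc, Matrix.mul_assoc]
    convert Matrix.mul_zero _
    ext i j
    have hij := congrFun (congrFun hD i) j
    rw [diagonal_mul, Matrix.zero_apply, mul_eq_zero] at hij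
    rw [diagonal_mul, Matrix.zero_apply, mul_eq_zero]
    refine hij.imp_left fun h0 => ?_
    rw [Complex.ofReal_eq_zero.mp h0, Real.zero_rpow ht, Complex.ofReal_zero]
  · exact Matrix.zero_mul M

theorem mpow_zero_matrix {ι : Type*} [Fintype ι] [DecidableEq ι] {t : ℝ} (ht : t ≠ 0) :
    mpow (0 : Matrix ι ι ℂ) t = 0 := by
  simpa using mpow_mul_eq_zero (M := 1) ht (Matrix.zero_mul (1 : Matrix ι ι ℂ))

/-- The α-fidelity of two matrices with product zero vanishes. -/
theorem aFid_eq_zero_of_mul_eq_zero {ι : Type*} [Fintype ι] [DecidableEq ι] {α : ℝ}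
    {ρ σ : Matrix ι ι ℂ} (h0 : 0 < α) (h1 : α < 1) (h : σ * ρ = 0) : aFid α ρ σ = 0 := by
  have hs : (1 - α) / (2 * α) ≠ 0 := (div_pos (by linarith) (by linarith)).ne'
  rw [aFid, mpow_mul_eq_zero hs h, Matrix.zero_mul, mpow_zero_matrix h0.ne', trace_zero,
    Complex.zero_re]

theorem Omega_posSemidef : Omega.PosSemidef := by
  have hO : Omega = (1 / 2 : ℂ) • vecMulVec
      (fun p : Fin 2 × Fin 2 => if p.1 = p.2 then (1 : ℂ) else 0)
      (star fun p : Fin 2 × Fin 2 => if p.1 = p.2 then (1 : ℂ) else 0) := by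
    ext p q
    by_cases hp : p.1 = p.2 <;> by_cases hq : q.1 = q.2 <;> simp [Omega, vecMulVec_apply, hp, hq]
  rw [hO]
  exact (posSemidef_vecMulVec_self_star _).smul (by positivity)

theorem pauli_isHermitian (i : Fin 3) : (pauli i).IsHermitian := by
  fin_cases i <;> ext a b <;> fin_cases a <;> fin_cases b <;> simp [pauli]

theorem rhoPrime_posSemidef : rhoPrime.PosSemidef := by
  refine (posSemidef_sum _ fun i _ => ?_).smul (by positivity)
  have h := Omega_posSemidef.mul_mul_conjTranspose_same
    (pauli i ⊗ₖ (1 : Matrix (Fin 2) (Fin 2) ℂ))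
  rwa [conjTranspose_kronecker, conjTranspose_one, (pauli_isHermitian i).eq] at h

theorem trace_Omega : Omega.trace = 1 := by
  simp [Omega, trace, Fintype.sum_prod_type]

theorem pauli_mul_self (i : Fin 3) : pauli i * pauli i = 1 := by
  fin_cases i <;> ext a b <;> fin_cases a <;> fin_cases b <;>
    simp [pauli, mul_apply]

theorem trace_rhoPrime : rhoPrime.trace = 1 := by
  have h (i : Fin 3) : ((pauli i ⊗ₖ (1 : Matrix (Fin 2) (Fin 2) ℂ)) * Omega *
      (pauli i ⊗ₖ (1 : Matrix (Fin 2) (Fin 2) ℂ))).trace = 1 := by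
    rw [trace_mul_comm, ← Matrix.mul_assoc, ← mul_kronecker_mul, pauli_mul_self,
      Matrix.one_mul, one_kronecker_one, Matrix.one_mul, trace_Omega]
  simp [rhoPrime, trace_smul, trace_sum, h]

/-- Compressing `A ⊗ I` to the range of `Ω` gives a multiple of `Ω` by `tr A / 2`. -/
theorem Omega_mul_kronecker_mul_Omega (A : Matrix (Fin 2) (Fin 2) ℂ) :
    Omega * (A ⊗ₖ (1 : Matrix (Fin 2) (Fin 2) ℂ)) * Omega = (A.trace / 2) • Omega := by
  ext ⟨a, b⟩ ⟨c, d⟩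
  simp [Omega, mul_apply, Fintype.sum_prod_type, trace, one_apply]
  split_ifs <;> ring

theorem trace_pauli (i : Fin 3) : (pauli i).trace = 0 := by
  fin_cases i <;> simp [pauli, trace]

theorem rhoPrime_mul_Omega : rhoPrime * Omega = 0 := by
  rw [rhoPrime, smul_mul_assoc, Finset.sum_mul, Finset.sum_eq_zero, smul_zero]
  intro i _
  rw [Matrix.mul_assoc, Matrix.mul_assoc, ← Matrix.mul_assoc Omega,
    Omega_mul_kronecker_mul_Omega, trace_pauli, zero_div, zero_smul, Matrix.mul_zero]

/-- `Ω` and `ρ'` are density matrices and their α-fidelity vanishes for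
all `α ∈ (0,1)`. -/
theorem stmt11 :
    IsDensity Omega ∧ IsDensity rhoPrime ∧
      ∀ α : ℝ, 0 < α → α < 1 → aFid α Omega rhoPrime = 0 :=
  ⟨⟨Omega_posSemidef, trace_Omega⟩, ⟨rhoPrime_posSemidef, trace_rhoPrime⟩,
    fun _ h0 h1 => aFid_eq_zero_of_mul_eq_zero h0 h1 rhoPrime_mul_Omega⟩
end

section
/- Let U be a unitary d×d complex matrix such that U is not a scalar multiple of the identity (U ≠ c·1 for every c ∈ ℂ). Then there exist unit vectors φ₁, φ₂ ∈ ℂ^d such that ⟨φ₁, φ₂⟩ ≠ 0 and ⟨φ₁, U φ₂⟩ = 0. -/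
open Matrix
open scoped Kronecker ComplexOrder

/-- A nonzero complex vector has a nonzero multiple of norm one. -/
theorem exists_smul_star_dotProduct_self_eq_one {ι : Type*} [Fintype ι] {v : ι → ℂ}
    (hv : v ≠ 0) : ∃ c : ℂ, c ≠ 0 ∧ star (c • v) ⬝ᵥ (c • v) = 1 := by
  have hpos : 0 < star v ⬝ᵥ v := dotProduct_star_self_pos_iff.mpr hv
  obtain ⟨r, hr, hrv⟩ : ∃ r : ℝ, 0 < r ∧ (r : ℂ) = star v ⬝ᵥ v :=
    ⟨_, (Complex.pos_iff.mp hpos).1, Complex.ext rfl (Complex.pos_iff.mp hpos).2⟩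
  have hs : (√r : ℝ) ≠ 0 := (Real.sqrt_pos.mpr hr).ne'
  refine ⟨((√r)⁻¹ : ℝ), by exact_mod_cast inv_ne_zero hs, ?_⟩
  have key : (√r)⁻¹ * ((√r)⁻¹ * r) = 1 := by
    field_simp
    exact (Real.sq_sqrt hr.le).symm
  rw [star_smul, smul_dotProduct, dotProduct_smul, ← hrv, smul_eq_mul, smul_eq_mul,
    Complex.star_def, Complex.conj_ofReal]
  exact_mod_cast key

/-- If `x` is not a multiple of `w ≠ 0`, some vector is orthogonal to `w` but not to `x`. -/
theorem exists_star_dotProduct_ne_zero_and_eq_zero {ι : Type*} [Fintype ι] {x w : ι → ℂ}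
    (hw : w ≠ 0) (hx : ∀ c : ℂ, x ≠ c • w) :
    ∃ v : ι → ℂ, star v ⬝ᵥ x ≠ 0 ∧ star v ⬝ᵥ w = 0 := by
  have hww : star w ⬝ᵥ w ≠ 0 := mt dotProduct_star_self_eq_zero.mp hw
  set c : ℂ := (star w ⬝ᵥ x) / (star w ⬝ᵥ w) with hc
  have hwv : star w ⬝ᵥ (x - c • w) = 0 := by
    rw [dotProduct_sub, dotProduct_smul, smul_eq_mul, hc, div_mul_cancel₀ _ hww, sub_self]
  have hvw : star (x - c • w) ⬝ᵥ w = 0 := by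
    rw [star_dotProduct, hwv, star_zero]
  refine ⟨x - c • w, fun h => ?_, hvw⟩
  have hvv : star (x - c • w) ⬝ᵥ (x - c • w) = 0 := by
    rw [dotProduct_sub, dotProduct_smul, h, hvw, smul_zero, sub_zero]
  exact hx c (sub_eq_zero.mp (dotProduct_star_self_eq_zero.mp hvv))

/-- for a unitary `U` which is not a scalar multiple of the identity,
there are non-orthogonal unit vectors `φ₁, φ₂` with `⟨φ₁, U φ₂⟩ = 0`. -/
theorem stmt12 {d : ℕ} (U : Matrix (Fin d) (Fin d) ℂ)
    (hU : U ∈ Matrix.unitaryGroup (Fin d) ℂ)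
    (hscalar : ∀ c : ℂ, U ≠ c • (1 : Matrix (Fin d) (Fin d) ℂ)) :
    ∃ φ₁ φ₂ : Fin d → ℂ,
      star φ₁ ⬝ᵥ φ₁ = 1 ∧ star φ₂ ⬝ᵥ φ₂ = 1 ∧
      star φ₁ ⬝ᵥ φ₂ ≠ 0 ∧ star φ₁ ⬝ᵥ (U *ᵥ φ₂) = 0 := by
  have hdep : ∃ x : Fin d → ℂ, LinearIndependent ℂ ![x, U *ᵥ x] := by
    by_contra! h
    obtain ⟨a, ha⟩ := (Matrix.toLin' U).exists_eq_smul_id_of_forall_notLinearIndependent h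
    refine hscalar a (Matrix.toLin'.injective ?_)
    rw [ha, map_smul, Matrix.toLin'_one]
    rfl
  obtain ⟨x, hx⟩ := hdep
  have hx0 : x ≠ 0 := hx.ne_zero 0
  have hw0 : U *ᵥ x ≠ 0 := hx.ne_zero 1
  have hxw : ∀ c : ℂ, x ≠ c • (U *ᵥ x) := fun c hc => by
    have := (LinearIndependent.pair_iff.mp hx 1 (-c) (by
      rw [one_smul, neg_smul, ← hc, add_neg_cancel])).1
    exact one_ne_zero this
  obtain ⟨v, hvx, hvw⟩ := exists_star_dotProduct_ne_zero_and_eq_zero hw0 hxw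
  have hv0 : v ≠ 0 := by
    rintro rfl
    simp at hvx
  obtain ⟨a, ha, hav⟩ := exists_smul_star_dotProduct_self_eq_one hv0
  obtain ⟨b, hb, hbx⟩ := exists_smul_star_dotProduct_self_eq_one hx0
  refine ⟨a • v, b • x, hav, hbx, ?_, ?_⟩
  · rw [star_smul, smul_dotProduct, dotProduct_smul]
    exact smul_ne_zero (star_ne_zero.mpr ha) (smul_ne_zero hb hvx)
  · rw [mulVec_smul, star_smul, smul_dotProduct, dotProduct_smul, hvw, smul_zero, smul_zero]
end

section
/- Let U be a unitary complex matrix with rows and columns indexed by Fin d × Fin m, let ξ₁, ξ₂ be density matrices on ℂ^m, and let U₁, U₂ be unitary d×d complex matrices such that U₁* U₂ is not a scalar multiple of the identity. Suppose that for i = 1, 2 and every density matrix ρ on ℂ^d one has Tr₂(U (ρ ⊗ ξ_i) U*) = U_i ρ U_i*. Then ξ₁ ξ₂ = 0, i.e. the two inducing (programming) states have orthogonal supports. -/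
open Matrix
open scoped Kronecker ComplexOrder

lemma ptrace2_mul_kronecker_mul_conjTranspose {ι κ : Type*} [Fintype ι] [DecidableEq ι]
    [Fintype κ] [DecidableEq κ] (U : Matrix (ι × κ) (ι × κ) ℂ) (B : Matrix κ κ ℂ)
    (ρ : Matrix ι ι ℂ) :
    ptrace2 (U * (ρ ⊗ₖ (B * Bᴴ)) * Uᴴ) =
      ∑ a : κ × κ, (Matrix.of fun i j => (U * ((1 : Matrix ι ι ℂ) ⊗ₖ B)) (i, a.1) (j, a.2)) * ρ *
        (Matrix.of fun i j => (U * ((1 : Matrix ι ι ℂ) ⊗ₖ B)) (i, a.1) (j, a.2))ᴴ := by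
  have h : U * (ρ ⊗ₖ (B * Bᴴ)) * Uᴴ =
      (U * (1 ⊗ₖ B)) * (ρ ⊗ₖ (1 : Matrix κ κ ℂ)) * (U * (1 ⊗ₖ B))ᴴ := by
    have : ρ ⊗ₖ (B * Bᴴ) = (1 ⊗ₖ B) * (ρ ⊗ₖ (1 : Matrix κ κ ℂ)) * (1 ⊗ₖ B)ᴴ := by
      rw [conjTranspose_kronecker, ← mul_kronecker_mul, ← mul_kronecker_mul]
      simp
    rw [this, conjTranspose_mul]
    simp only [Matrix.mul_assoc]
  rw [h]
  generalize U * (1 ⊗ₖ B) = X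
  ext i i'
  simp only [ptrace2, of_apply, Matrix.sum_apply, Fintype.sum_prod_type]
  refine Finset.sum_congr rfl fun k _ => ?_
  simp only [mul_apply, Fintype.sum_prod_type, kronecker_apply, one_apply, mul_ite, mul_one,
    mul_zero, Finset.sum_ite_eq', Finset.mem_univ, if_true, conjTranspose_apply, of_apply]
  exact Finset.sum_comm

lemma exists_eq_smul_one_of_dotProduct_eq_zero {ι : Type*} [Fintype ι] [DecidableEq ι]
    (L : Matrix ι ι ℂ) (h : ∀ v w : ι → ℂ, star w ⬝ᵥ v = 0 → star w ⬝ᵥ (L *ᵥ v) = 0) :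
    ∃ c : ℂ, L = c • (1 : Matrix ι ι ℂ) := by
  have hoff : ∀ i j, i ≠ j → L i j = 0 := fun i j hij => by
    simpa [← Pi.single_star] using h (Pi.single j 1) (Pi.single i 1) (by simp [hij])
  have hdiag : ∀ i j, L i i = L j j := fun i j => by
    rcases eq_or_ne i j with rfl | hij
    · rfl
    have := h (Pi.single i 1 + Pi.single j 1) (Pi.single i 1 - Pi.single j 1) (by
      simp [hij, hij.symm])
    simp [mulVec_add, hoff i j hij, hoff j i hij.symm] at this
    exact sub_eq_zero.mp this
  rcases isEmpty_or_nonempty ι with _ | ⟨⟨i₀⟩⟩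
  · exact ⟨0, Subsingleton.elim _ _⟩
  refine ⟨L i₀ i₀, ?_⟩
  ext i j
  rcases eq_or_ne i j with rfl | hij
  · simp [hdiag i i₀]
  · simp [hij, hoff i j hij]

lemma dotProduct_mul_vecMulVec_mul_conjTranspose {ι : Type*} [Fintype ι]
    (K : Matrix ι ι ℂ) (v u : ι → ℂ) :
    star u ⬝ᵥ ((K * vecMulVec v (star v) * Kᴴ) *ᵥ u) =
      ((‖star u ⬝ᵥ (K *ᵥ v)‖ ^ 2 : ℝ) : ℂ) := by
  have h : star v ᵥ* Kᴴ = star (K *ᵥ v) := (star_mulVec K v).symm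
  rw [mul_vecMulVec, vecMulVec_mul, h, vecMulVec_mulVec]
  rw [star_dotProduct (K *ᵥ v) u, dotProduct_smul]
  simp [Complex.mul_conj, Complex.normSq_eq_norm_sq]

lemma sum_conj_vecMulVec_eq {ι α : Type*} [Fintype ι] [Fintype α]
    (K : α → Matrix ι ι ℂ) (V : Matrix ι ι ℂ)
    (h : ∀ ρ, IsDensity ρ → ∑ a, K a * ρ * (K a)ᴴ = V * ρ * Vᴴ) (v : ι → ℂ) :
    ∑ a, K a * vecMulVec v (star v) * (K a)ᴴ = V * vecMulVec v (star v) * Vᴴ := by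
  rcases eq_or_ne v 0 with rfl | hv
  · simp
  have hpos : 0 < v ⬝ᵥ star v := by
    rwa [dotProduct_comm, dotProduct_star_self_pos_iff]
  have hd : IsDensity ((v ⬝ᵥ star v)⁻¹ • vecMulVec v (star v)) := by
    refine ⟨(posSemidef_vecMulVec_self_star v).smul (inv_nonneg.mpr hpos.le), ?_⟩
    rw [trace_smul, trace_vecMulVec, smul_eq_mul, inv_mul_cancel₀ hpos.ne']
  have := h _ hd
  simp only [Matrix.mul_smul, Matrix.smul_mul, ← Finset.smul_sum] at this
  exact smul_right_injective _ (inv_ne_zero hpos.ne') this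

/-- Every Kraus operator of a unitary channel is a scalar multiple of the unitary. -/
lemma exists_kraus_eq_smul_unitary {ι α : Type*} [Fintype ι] [DecidableEq ι] [Fintype α]
    (K : α → Matrix ι ι ℂ) (V : Matrix ι ι ℂ) (hV : V ∈ Matrix.unitaryGroup ι ℂ)
    (h : ∀ ρ, IsDensity ρ → ∑ a, K a * ρ * (K a)ᴴ = V * ρ * Vᴴ) (a : α) :
    ∃ c : ℂ, K a = c • V := by
  have hVV : Vᴴ * V = 1 := mem_unitaryGroup_iff'.mp hV
  have hVV' : V * Vᴴ = 1 := mem_unitaryGroup_iff.mp hV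
  have hstar : ∀ (M : Matrix ι ι ℂ) (v w : ι → ℂ),
      star (V *ᵥ w) ⬝ᵥ (M *ᵥ v) = star w ⬝ᵥ ((Vᴴ * M) *ᵥ v) := fun M v w => by
    rw [star_mulVec, ← dotProduct_mulVec, mulVec_mulVec]
  obtain ⟨c, hc⟩ := exists_eq_smul_one_of_dotProduct_eq_zero (Vᴴ * K a) fun v w hvw => by
    have hs := congrArg (fun M => star (V *ᵥ w) ⬝ᵥ (M *ᵥ (V *ᵥ w)))
      (sum_conj_vecMulVec_eq K V h v)
    simp only [sum_mulVec, dotProduct_sum, dotProduct_mul_vecMulVec_mul_conjTranspose] at hs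
    rw [hstar V v w, hVV, one_mulVec, hvw, ← Complex.ofReal_sum, Complex.ofReal_inj, norm_zero,
      zero_pow two_ne_zero, Finset.sum_eq_zero_iff_of_nonneg fun _ _ => by positivity] at hs
    have := hs a (Finset.mem_univ a)
    rwa [sq_eq_zero_iff, norm_eq_zero, hstar] at this
  refine ⟨c, ?_⟩
  rw [← one_mul (K a), ← hVV', Matrix.mul_assoc, hc, Matrix.mul_smul, mul_one]

lemma exists_mul_one_kronecker_eq {ι κ : Type*} [Fintype ι] [DecidableEq ι]
    [Fintype κ] [DecidableEq κ] (U : Matrix (ι × κ) (ι × κ) ℂ) (B : Matrix κ κ ℂ)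
    (V : Matrix ι ι ℂ) (hV : V ∈ Matrix.unitaryGroup ι ℂ)
    (h : ∀ ρ, IsDensity ρ → ptrace2 (U * (ρ ⊗ₖ (B * Bᴴ)) * Uᴴ) = V * ρ * Vᴴ) :
    ∃ C : Matrix κ κ ℂ, U * (1 ⊗ₖ B) = V ⊗ₖ C := by
  simp only [ptrace2_mul_kronecker_mul_conjTranspose] at h
  choose c hc using exists_kraus_eq_smul_unitary _ V hV h
  refine ⟨Matrix.of fun k l => c (k, l), ?_⟩
  ext ⟨i, k⟩ ⟨j, l⟩
  simpa [mul_comm] using congrFun (congrFun (hc (k, l)) i) j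

lemma exists_eq_mul_conjTranspose {κ : Type*} [Fintype κ] [DecidableEq κ]
    {ξ : Matrix κ κ ℂ} (h : ξ.PosSemidef) : ∃ B : Matrix κ κ ℂ, ξ = B * Bᴴ := by
  open scoped MatrixOrder in
  obtain ⟨B, hB⟩ := CStarAlgebra.nonneg_iff_eq_star_mul_self.mp h.nonneg
  exact ⟨Bᴴ, by simpa [star_eq_conjTranspose] using hB⟩

/-- two programming states inducing two different unitary channels through
a common processor must have orthogonal supports. -/
theorem stmt14 {d m : ℕ} (U : Matrix (Fin d × Fin m) (Fin d × Fin m) ℂ)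
    (hU : U ∈ Matrix.unitaryGroup (Fin d × Fin m) ℂ)
    (ξ₁ ξ₂ : Matrix (Fin m) (Fin m) ℂ) (hξ₁ : IsDensity ξ₁) (hξ₂ : IsDensity ξ₂)
    (U₁ U₂ : Matrix (Fin d) (Fin d) ℂ)
    (hU₁ : U₁ ∈ Matrix.unitaryGroup (Fin d) ℂ) (hU₂ : U₂ ∈ Matrix.unitaryGroup (Fin d) ℂ)
    (hscalar : ∀ c : ℂ, U₁ᴴ * U₂ ≠ c • (1 : Matrix (Fin d) (Fin d) ℂ))
    (h₁ : ∀ ρ : Matrix (Fin d) (Fin d) ℂ, IsDensity ρ →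
      ptrace2 (U * (ρ ⊗ₖ ξ₁) * Uᴴ) = U₁ * ρ * U₁ᴴ)
    (h₂ : ∀ ρ : Matrix (Fin d) (Fin d) ℂ, IsDensity ρ →
      ptrace2 (U * (ρ ⊗ₖ ξ₂) * Uᴴ) = U₂ * ρ * U₂ᴴ) :
    ξ₁ * ξ₂ = 0 := by
  obtain ⟨B₁, rfl⟩ := exists_eq_mul_conjTranspose hξ₁.1
  obtain ⟨B₂, rfl⟩ := exists_eq_mul_conjTranspose hξ₂.1
  obtain ⟨C₁, hC₁⟩ := exists_mul_one_kronecker_eq U B₁ U₁ hU₁ h₁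
  obtain ⟨C₂, hC₂⟩ := exists_mul_one_kronecker_eq U B₂ U₂ hU₂ h₂
  have hUU : Uᴴ * U = 1 := mem_unitaryGroup_iff'.mp hU
  have key : (1 : Matrix (Fin d) (Fin d) ℂ) ⊗ₖ (B₁ᴴ * B₂) = (U₁ᴴ * U₂) ⊗ₖ (C₁ᴴ * C₂) := by
    rw [mul_kronecker_mul, ← conjTranspose_kronecker, ← hC₁, ← hC₂, conjTranspose_mul,
      Matrix.mul_assoc, ← Matrix.mul_assoc Uᴴ, hUU, one_mul, conjTranspose_kronecker,
      ← mul_kronecker_mul]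
    simp
  have hC : C₁ᴴ * C₂ = 0 := by
    ext k l
    by_contra hne
    refine hscalar ((B₁ᴴ * B₂) k l / (C₁ᴴ * C₂) k l) ?_
    ext i j
    have := congrFun (congrFun key (i, k)) (j, l)
    simp only [kronecker_apply] at this
    rw [Matrix.smul_apply, smul_eq_mul, div_mul_eq_mul_div, mul_comm, this, mul_div_cancel_right₀ _ hne]
  have hd : Nonempty (Fin d) := by
    by_contra hd
    rw [not_nonempty_iff] at hd
    exact hscalar 0 (Subsingleton.elim _ _)
  have hB : B₁ᴴ * B₂ = 0 := by
    obtain ⟨i⟩ := hd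
    ext k l
    simpa [hC] using congrFun (congrFun key (i, k)) (i, l)
  rw [Matrix.mul_assoc, ← Matrix.mul_assoc B₁ᴴ, hB, Matrix.zero_mul, Matrix.mul_zero]
end

section
/- Let S be the complex matrix with rows and columns indexed by Fin m × Fin m and entries S_{(i,k),(j,l)} = δ_{i l}·δ_{k j} (the SWAP operator). Then: (i) S is unitary and for all density matrices ρ, ξ on ℂ^m one has Tr₂(S (ρ ⊗ ξ) S*) = ξ; (ii) for all density matrices ξ₁, ξ₂ on ℂ^m, the preparation channels E_{ξ_i}(X) = tr(X)·ξ_i satisfy 𝓕_α(E_{ξ₁}, E_{ξ₂}) = F_α(ξ₁, ξ₂) for every α ∈ (0,1). -/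
open Matrix
open scoped Kronecker ComplexOrder

/-- The SWAP operator on `ℂ^m ⊗ ℂ^m`, with entries `S_{(i,k),(j,l)} = δ_{il} δ_{kj}`. -/
noncomputable def swapOp (m : ℕ) : Matrix (Fin m × Fin m) (Fin m × Fin m) ℂ :=
  Matrix.of fun p q => if p.1 = q.2 ∧ p.2 = q.1 then 1 else 0

theorem swapOp_eq_submatrix (m : ℕ) :
    swapOp m = (1 : Matrix (Fin m × Fin m) (Fin m × Fin m) ℂ).submatrix
      (Equiv.prodComm (Fin m) (Fin m)) (Equiv.refl _) := by
  ext p q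
  simp only [swapOp, of_apply, submatrix_apply, one_apply, Prod.ext_iff, Equiv.prodComm_apply,
    Equiv.refl_apply, Prod.fst_swap, Prod.snd_swap]
  congr 1
  exact propext and_comm

theorem swapOp_mul_mul_conjTranspose {m : ℕ} (A : Matrix (Fin m × Fin m) (Fin m × Fin m) ℂ) :
    swapOp m * A * (swapOp m)ᴴ = A.submatrix Prod.swap Prod.swap := by
  rw [swapOp_eq_submatrix, conjTranspose_submatrix, conjTranspose_one, one_submatrix_mul,
    mul_submatrix_one]
  rfl

theorem swapOp_mem_unitaryGroup (m : ℕ) :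
    swapOp m ∈ Matrix.unitaryGroup (Fin m × Fin m) ℂ := by
  rw [mem_unitaryGroup_iff, star_eq_conjTranspose]
  have h := swapOp_mul_mul_conjTranspose (1 : Matrix (Fin m × Fin m) (Fin m × Fin m) ℂ)
  rw [Matrix.mul_one] at h
  rw [h]
  exact submatrix_one _ Prod.swap_injective

theorem ptrace2_swapOp_conj {m : ℕ} (ρ ξ : Matrix (Fin m) (Fin m) ℂ) :
    ptrace2 (swapOp m * (ρ ⊗ₖ ξ) * (swapOp m)ᴴ) = ρ.trace • ξ := by
  ext i j
  simp [swapOp_mul_mul_conjTranspose, ptrace2, trace, Finset.sum_mul]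

section Fidelity

variable {ι : Type*} [Fintype ι] [DecidableEq ι]

theorem re_trace_mpow {A : Matrix ι ι ℂ} (hA : A.IsHermitian) (t : ℝ) :
    (trace (mpow A t)).re = ∑ i, hA.eigenvalues i ^ t := by
  rw [mpow, dif_pos hA, trace_mul_comm, ← Matrix.mul_assoc, Unitary.coe_star_mul_self,
    Matrix.one_mul, trace_diagonal, ← Complex.ofReal_sum, Complex.ofReal_re]

theorem isHermitian_mpow (A : Matrix ι ι ℂ) (t : ℝ) : (mpow A t).IsHermitian := by
  unfold mpow
  split_ifs with hA
  · refine isHermitian_mul_mul_conjTranspose _ (isHermitian_diagonal_of_self_adjoint _ ?_)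
    ext i
    simp
  · exact isHermitian_zero

theorem posSemidef_mpow_conj {ρ : Matrix ι ι ℂ} (hρ : ρ.PosSemidef) (σ : Matrix ι ι ℂ) (t : ℝ) :
    (mpow σ t * ρ * mpow σ t).PosSemidef := by
  have h := hρ.mul_mul_conjTranspose_same (mpow σ t)
  rwa [(isHermitian_mpow σ t).eq] at h

theorem aFid_nonneg {ρ : Matrix ι ι ℂ} (hρ : ρ.PosSemidef) (σ : Matrix ι ι ℂ) (α : ℝ) :
    0 ≤ aFid α ρ σ := by
  have hM := posSemidef_mpow_conj hρ σ ((1 - α) / (2 * α))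
  rw [aFid, re_trace_mpow hM.isHermitian]
  exact Finset.sum_nonneg fun i _ => Real.rpow_nonneg (hM.eigenvalues_nonneg i) _

theorem sum_normSq_row {P : Matrix ι ι ℂ} (hP : P * Pᴴ = 1) (j : ι) :
    ∑ i, Complex.normSq (P j i) = 1 := by
  have h := congrFun (congrFun hP j) j
  simp only [mul_apply, conjTranspose_apply, one_apply_eq] at h
  apply Complex.ofReal_injective
  simpa [Complex.mul_conj] using h

theorem sum_normSq_col {P : Matrix ι ι ℂ} (hP : Pᴴ * P = 1) (i : ι) :
    ∑ j, Complex.normSq (P j i) = 1 := by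
  simpa using sum_normSq_row (P := Pᴴ) (by simpa using hP) i

/-- The overlaps between the eigenbases of `σ` and of `σ ^ t * ρ * σ ^ t`: in an eigenbasis of `σ`
the second matrix is both `P Λ Pᴴ`, for a unitary `P`, and `s ^ t R s ^ t`. -/
theorem exists_unitary_overlap {ρ σ : Matrix ι ι ℂ} (hσ : σ.IsHermitian) (t : ℝ)
    (hM : (mpow σ t * ρ * mpow σ t).IsHermitian) :
    ∃ P : Matrix ι ι ℂ, P * Pᴴ = 1 ∧ Pᴴ * P = 1 ∧
      P * diagonal (fun i => (hM.eigenvalues i : ℂ)) * Pᴴ =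
        diagonal (fun i => ((hσ.eigenvalues i ^ t : ℝ) : ℂ)) *
          ((hσ.eigenvectorUnitary : Matrix ι ι ℂ)ᴴ * ρ * (hσ.eigenvectorUnitary : Matrix ι ι ℂ)) *
          diagonal (fun i => ((hσ.eigenvalues i ^ t : ℝ) : ℂ)) := by
  have hspec := hM.spectral_theorem
  rw [Unitary.conjStarAlgAut_apply] at hspec
  set U : Matrix ι ι ℂ := (hσ.eigenvectorUnitary : Matrix ι ι ℂ)
  set V : Matrix ι ι ℂ := (hM.eigenvectorUnitary : Matrix ι ι ℂ)
  have hU1 : Uᴴ * U = 1 := Unitary.coe_star_mul_self hσ.eigenvectorUnitary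
  have hU2 : U * Uᴴ = 1 := Unitary.coe_mul_star_self hσ.eigenvectorUnitary
  have hV1 : Vᴴ * V = 1 := Unitary.coe_star_mul_self hM.eigenvectorUnitary
  have hV2 : V * Vᴴ = 1 := Unitary.coe_mul_star_self hM.eigenvectorUnitary
  set D := diagonal (fun i => ((hσ.eigenvalues i ^ t : ℝ) : ℂ))
  have hB : mpow σ t = U * D * Uᴴ := by rw [mpow, dif_pos hσ]; rfl
  refine ⟨Uᴴ * V, ?_, ?_, ?_⟩
  · rw [conjTranspose_mul, conjTranspose_conjTranspose]
    calc Uᴴ * V * (Vᴴ * U) = Uᴴ * (V * Vᴴ) * U := by simp only [Matrix.mul_assoc]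
      _ = 1 := by rw [hV2, Matrix.mul_one, hU1]
  · rw [conjTranspose_mul, conjTranspose_conjTranspose]
    calc Vᴴ * U * (Uᴴ * V) = Vᴴ * (U * Uᴴ) * V := by simp only [Matrix.mul_assoc]
      _ = 1 := by rw [hU2, Matrix.mul_one, hV1]
  · rw [conjTranspose_mul, conjTranspose_conjTranspose]
    calc Uᴴ * V * diagonal (fun i => (hM.eigenvalues i : ℂ)) * (Vᴴ * U)
        = Uᴴ * (V * diagonal (fun i => (hM.eigenvalues i : ℂ)) * Vᴴ) * U := by
          simp only [Matrix.mul_assoc]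
      _ = Uᴴ * (mpow σ t * ρ * mpow σ t) * U := by
          conv_rhs => rw [hspec]
          rfl
      _ = (Uᴴ * U) * D * (Uᴴ * ρ * U) * D * (Uᴴ * U) := by
          rw [hB]; simp only [Matrix.mul_assoc]
      _ = D * (Uᴴ * ρ * U) * D := by rw [hU1, Matrix.one_mul, Matrix.mul_one]

theorem sum_normSq_mul_eq {P Q : Matrix ι ι ℂ} {lam d : ι → ℝ}
    (h : P * diagonal (fun i => (lam i : ℂ)) * Pᴴ =
      diagonal (fun i => (d i : ℂ)) * Q * diagonal (fun i => (d i : ℂ))) (j : ι) :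
    ∑ i, Complex.normSq (P j i) * lam i = d j * d j * (Q j j).re := by
  have h' := congrFun (congrFun h j) j
  rw [mul_apply, mul_diagonal, diagonal_mul] at h'
  simp only [mul_diagonal, conjTranspose_apply] at h'
  have h'' := congrArg Complex.re h'
  rw [Complex.re_sum] at h''
  convert h'' using 1
  · refine Finset.sum_congr rfl fun i _ => ?_
    simp [Complex.normSq_apply]
    ring
  · simp
    ring

theorem IsDensity.sum_eigenvalues {σ : Matrix ι ι ℂ} (hσ : IsDensity σ) :
    ∑ i, hσ.1.isHermitian.eigenvalues i = 1 := by
  have h := hσ.2.symm.trans hσ.1.isHermitian.trace_eq_sum_eigenvalues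
  apply Complex.ofReal_injective
  simpa using h.symm

/-- Hölder's inequality for the α-fidelity, valid on the whole range `0 < α < 1`. -/
theorem aFid_le_one {α : ℝ} (h0 : 0 < α) (h1 : α < 1) {ρ σ : Matrix ι ι ℂ}
    (hρ : IsDensity ρ) (hσ : IsDensity σ) : aFid α ρ σ ≤ 1 := by
  set t := (1 - α) / (2 * α) with ht
  have ht0 : 0 < t := div_pos (by linarith) (by linarith)
  have hM := posSemidef_mpow_conj hρ.1 σ t
  obtain ⟨P, hP1, hP2, hP⟩ := exists_unitary_overlap hσ.1.isHermitian t hM.isHermitian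
  rw [aFid, ← ht, re_trace_mpow hM.isHermitian]
  set lam := hM.isHermitian.eigenvalues
  set s := hσ.1.isHermitian.eigenvalues with hs
  set U : Matrix ι ι ℂ := (hσ.1.isHermitian.eigenvectorUnitary : Matrix ι ι ℂ)
  have hR : (Uᴴ * ρ * U).PosSemidef := hρ.1.conjTranspose_mul_mul_same U
  have hRtr : ∑ j, ((Uᴴ * ρ * U) j j).re = 1 := by
    have htr : (Uᴴ * ρ * U).trace = 1 := by
      rw [trace_mul_comm, ← Matrix.mul_assoc,
        show U * Uᴴ = 1 from Unitary.coe_mul_star_self hσ.1.isHermitian.eigenvectorUnitary,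
        Matrix.one_mul, hρ.2]
    simpa [trace] using congrArg Complex.re htr
  set R := Uᴴ * ρ * U
  have hlam : ∀ i, 0 ≤ lam i := hM.eigenvalues_nonneg
  have hs0 : ∀ j, 0 ≤ s j := hσ.1.eigenvalues_nonneg
  have hdiag := sum_normSq_mul_eq hP
  have key : ∀ i j, Complex.normSq (P j i) * lam i ^ α ≤
      α * (Complex.normSq (P j i) * lam i / (s j ^ t * s j ^ t)) +
        (1 - α) * (Complex.normSq (P j i) * s j) := by
    intro i j
    have hc : 0 ≤ Complex.normSq (P j i) := Complex.normSq_nonneg _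
    rcases (hs0 j).eq_or_lt with hj | hj
    · have hz := hdiag j
      rw [← hj, Real.zero_rpow ht0.ne', zero_mul, zero_mul,
        Finset.sum_eq_zero_iff_of_nonneg fun i _ => mul_nonneg (Complex.normSq_nonneg _) (hlam i)]
        at hz
      rcases mul_eq_zero.1 (hz i (Finset.mem_univ i)) with h | h
      · simp [h]
      · simp [h, Real.zero_rpow h0.ne', ← hj]
    · have hw : 0 < s j ^ t * s j ^ t := by positivity
      have hwα : (s j ^ t * s j ^ t) ^ α = s j ^ (1 - α) := by
        rw [← Real.rpow_add hj, ← Real.rpow_mul hj.le, ht]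
        congr 1
        field_simp
        ring
      have hamgm := Real.geom_mean_le_arith_mean2_weighted h0.le (by linarith : 0 ≤ 1 - α)
        (div_nonneg (hlam i) hw.le) hj.le (by ring)
      rw [Real.div_rpow (hlam i) hw.le, hwα, div_mul_cancel₀ _ (Real.rpow_pos_of_pos hj _).ne']
        at hamgm
      calc _ ≤ Complex.normSq (P j i) * (α * (lam i / (s j ^ t * s j ^ t)) + (1 - α) * s j) :=
            mul_le_mul_of_nonneg_left hamgm hc
        _ = _ := by ring
  have hrow : ∀ j, ∑ i, Complex.normSq (P j i) * lam i / (s j ^ t * s j ^ t) ≤ (R j j).re := by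
    intro j
    have hRj : 0 ≤ (R j j).re := (Complex.le_def.1 (hR.diag_nonneg (i := j))).1
    rw [← Finset.sum_div, hdiag j]
    exact div_le_of_le_mul₀ (by have := Real.rpow_nonneg (hs0 j) t; positivity) hRj
      (mul_comm _ _).le
  calc ∑ i, lam i ^ α = ∑ i, ∑ j, Complex.normSq (P j i) * lam i ^ α := by
        simp_rw [← Finset.sum_mul, sum_normSq_col hP2, one_mul]
    _ = ∑ j, ∑ i, Complex.normSq (P j i) * lam i ^ α := Finset.sum_comm
    _ ≤ ∑ j, ∑ i, (α * (Complex.normSq (P j i) * lam i / (s j ^ t * s j ^ t)) +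
          (1 - α) * (Complex.normSq (P j i) * s j)) :=
        Finset.sum_le_sum fun j _ => Finset.sum_le_sum fun i _ => key i j
    _ = ∑ j, (α * (∑ i, Complex.normSq (P j i) * lam i / (s j ^ t * s j ^ t)) +
          (1 - α) * s j) := by
        refine Finset.sum_congr rfl fun j _ => ?_
        rw [Finset.sum_add_distrib, ← Finset.mul_sum, ← Finset.mul_sum, ← Finset.sum_mul,
          sum_normSq_row hP1, one_mul]
    _ ≤ ∑ j, (α * (R j j).re + (1 - α) * s j) :=
        Finset.sum_le_sum fun j _ =>
          add_le_add (mul_le_mul_of_nonneg_left (hrow j) h0.le) le_rfl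
    _ = 1 := by
        rw [Finset.sum_add_distrib, ← Finset.mul_sum, ← Finset.mul_sum, hRtr, hs,
          hσ.sum_eigenvalues]
        ring

theorem aFid_self {α : ℝ} (h0 : 0 < α) (h1 : α < 1) {ρ : Matrix ι ι ℂ} (hρ : IsDensity ρ) :
    aFid α ρ ρ = 1 := by
  set t := (1 - α) / (2 * α) with ht
  have ht0 : 0 < t := div_pos (by linarith) (by linarith)
  have hM := posSemidef_mpow_conj hρ.1 ρ t
  obtain ⟨P, hP1, hP2, hP⟩ := exists_unitary_overlap hρ.1.isHermitian t hM.isHermitian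
  have hR : (hρ.1.isHermitian.eigenvectorUnitary : Matrix ι ι ℂ)ᴴ * ρ *
      (hρ.1.isHermitian.eigenvectorUnitary : Matrix ι ι ℂ) =
      diagonal (fun i => (hρ.1.isHermitian.eigenvalues i : ℂ)) := by
    have h := Matrix.IsHermitian.conjStarAlgAut_star_eigenvectorUnitary hρ.1.isHermitian
    rw [Unitary.conjStarAlgAut_star_apply] at h
    exact h
  rw [hR, diagonal_mul_diagonal, diagonal_mul_diagonal] at hP
  rw [aFid, ← ht, re_trace_mpow hM.isHermitian]
  set lam := hM.isHermitian.eigenvalues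
  set s := hρ.1.isHermitian.eigenvalues
  have hs0 : ∀ j, 0 ≤ s j := hρ.1.eigenvalues_nonneg
  have hcomm := congrArg (· * P) hP
  simp only [Matrix.mul_assoc, hP2, Matrix.mul_one] at hcomm
  have key : ∀ i j, Complex.normSq (P j i) * lam i ^ α = Complex.normSq (P j i) * s j := by
    intro i j
    by_cases hz : P j i = 0
    · simp [hz]
    have hij := congrFun (congrFun hcomm j) i
    rw [mul_diagonal, diagonal_mul, mul_comm] at hij
    have hl : lam i = s j ^ t * s j * s j ^ t := by
      have := mul_right_cancel₀ hz hij
      exact_mod_cast this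
    rw [hl]
    rcases (hs0 j).eq_or_lt with hj | hj
    · simp [← hj, Real.zero_rpow h0.ne']
    · have hexp : s j ^ t * s j * s j ^ t = s j ^ (1 / α) := by
        nth_rewrite 2 [← Real.rpow_one (s j)]
        rw [← Real.rpow_add hj, ← Real.rpow_add hj, ht]
        congr 1
        field_simp
        ring
      rw [hexp, ← Real.rpow_mul hj.le, one_div_mul_cancel h0.ne', Real.rpow_one]
  calc ∑ i, lam i ^ α = ∑ i, ∑ j, Complex.normSq (P j i) * lam i ^ α := by
        simp_rw [← Finset.sum_mul, sum_normSq_col hP2, one_mul]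
    _ = ∑ j, ∑ i, Complex.normSq (P j i) * s j := by
        rw [Finset.sum_comm]
        simp_rw [key]
    _ = 1 := by
        simp_rw [← Finset.sum_mul, sum_normSq_row hP1, one_mul]
        exact hρ.sum_eigenvalues

theorem chanFid_preparation {κ : Type*} [Fintype κ] [DecidableEq κ] {α : ℝ}
    (h0 : 0 < α) (h1 : α < 1) {ξ₁ ξ₂ : Matrix κ κ ℂ}
    (hξ₁ : ξ₁.PosSemidef) {ρ : Matrix ι ι ℂ} (hρ : IsDensity ρ) :
    chanFid α (fun X : Matrix ι ι ℂ => X.trace • ξ₁) (fun X : Matrix ι ι ℂ => X.trace • ξ₂) =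
      aFid α ξ₁ ξ₂ := by
  refine IsLeast.csInf_eq ⟨⟨ρ, ρ, hρ, hρ, ?_, ?_⟩, ?_⟩
  · rw [aFid_self h0 h1 hρ]
    exact one_pos
  · simp only [hρ.2, one_smul, aFid_self h0 h1 hρ, div_one]
  · rintro r ⟨ρ₁, ρ₂, hρ₁, hρ₂, hpos, rfl⟩
    simp only [hρ₁.2, hρ₂.2, one_smul]
    exact le_div_self (aFid_nonneg hξ₁ ξ₂ α) hpos (aFid_le_one h0 h1 hρ₁ hρ₂)

end Fidelity

/-- (i) the SWAP operator is unitary and programs every preparation channel;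
(ii) for preparation channels `E_{ξ}(X) = tr(X)·ξ`, the channel α-fidelity equals the
α-fidelity of the prepared states. -/
theorem stmt15 {m : ℕ} :
    (swapOp m ∈ Matrix.unitaryGroup (Fin m × Fin m) ℂ ∧
      ∀ ρ ξ : Matrix (Fin m) (Fin m) ℂ, IsDensity ρ → IsDensity ξ →
        ptrace2 (swapOp m * (ρ ⊗ₖ ξ) * (swapOp m)ᴴ) = ξ) ∧
    ∀ α : ℝ, 0 < α → α < 1 → ∀ ξ₁ ξ₂ : Matrix (Fin m) (Fin m) ℂ,
      IsDensity ξ₁ → IsDensity ξ₂ →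
      chanFid α (fun X : Matrix (Fin m) (Fin m) ℂ => X.trace • ξ₁)
        (fun X : Matrix (Fin m) (Fin m) ℂ => X.trace • ξ₂) = aFid α ξ₁ ξ₂ := by
  refine ⟨⟨swapOp_mem_unitaryGroup m, fun ρ ξ hρ _ => ?_⟩, fun α h0 h1 ξ₁ ξ₂ hξ₁ _ =>
    chanFid_preparation h0 h1 hξ₁.1 hξ₁⟩
  rw [ptrace2_swapOp_conj, hρ.2, one_smul]
end

section
/- For every α ∈ [1/2, 1) and all density matrices ρ₁, ρ₂ on ℂ^n, one has F_α(ρ₁, ρ₂) ≤ F_{1−α}(ρ₂, ρ₁), i.e. tr[(ρ₂^((1−α)/(2α)) ρ₁ ρ₂^((1−α)/(2α)))^α] ≤ tr[(ρ₁^(α/(2(1−α))) ρ₂ ρ₁^(α/(2(1−α))))^(1−α)]. -/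
open Matrix
open scoped Kronecker ComplexOrder

section CStar
variable {A : Type*} [CStarAlgebra A] [PartialOrder A] [StarOrderedRing A]

theorem CFC.rpow_half_mul_rpow_half {a : A} (ha : 0 ≤ a) {s : ℝ} (hs : 0 ≤ s) :
    a ^ (s / 2) * a ^ (s / 2) = a ^ s := by
  have h := CFC.rpow_rpow_of_exponent_nonneg a (s / 2) 2 (by positivity) (by norm_num)
  rw [← sq, ← CFC.rpow_natCast _ _ CFC.rpow_nonneg]
  simpa using h

theorem CFC.smul_rpow (c : NNReal) (a : A) (ha : 0 ≤ a) {s : ℝ} (hs : 0 < s) :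
    (c • a) ^ s = c ^ s • a ^ s := by
  have hc : Continuous fun x : NNReal => x ^ s := NNReal.continuous_rpow_const hs.le
  rw [CFC.rpow_def, CFC.rpow_def, ← cfc_comp_smul c (fun x : NNReal => x ^ s) a hc.continuousOn ha,
    ← cfc_smul (c ^ s) (fun x : NNReal => x ^ s) a hc.continuousOn]
  simp [NNReal.mul_rpow]

theorem norm_rpow_mul_rpow_sq {a b : A} (ha : 0 ≤ a) {s : ℝ} (hs : 0 ≤ s) (t : ℝ) :
    ‖a ^ (s / 2) * b ^ t‖ ^ 2 = ‖b ^ t * a ^ s * b ^ t‖ := by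
  rw [sq, ← CStarRing.norm_star_mul_self, star_mul, (CFC.rpow_nonneg (a := a)).isSelfAdjoint.star_eq,
    (CFC.rpow_nonneg (a := b)).isSelfAdjoint.star_eq, ← CFC.rpow_half_mul_rpow_half ha hs]
  simp only [mul_assoc]

theorem norm_rpow_mul_rpow_comm {a b : A} (s t : ℝ) : ‖a ^ s * b ^ t‖ = ‖b ^ t * a ^ s‖ := by
  rw [← norm_star, star_mul, (CFC.rpow_nonneg (a := a)).isSelfAdjoint.star_eq,
    (CFC.rpow_nonneg (a := b)).isSelfAdjoint.star_eq]

theorem norm_rpow_mul_rpow_sq_le_of_isStrictlyPositive {a b : A} (ha : 0 ≤ a)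
    (hb : IsStrictlyPositive b) {s : ℝ} (hs₀ : 0 < s) (hs₁ : s ≤ 1) {μ : ℝ} (hμ : 0 ≤ μ)
    (h : ‖b ^ (1 / 2 : ℝ) * a * b ^ (1 / 2 : ℝ)‖ ≤ μ) :
    ‖b ^ (s / 2) * a ^ s * b ^ (s / 2)‖ ≤ μ ^ s := by
  lift μ to NNReal using hμ
  have hbp : ∀ x : ℝ, 0 ≤ b ^ x := fun x => CFC.rpow_nonneg
  have hmid : ∀ (x : ℝ) (c : A), 0 ≤ c → 0 ≤ b ^ x * c * b ^ x := fun x c hc => by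
    simpa using conjugate_le_conjugate_of_nonneg hc (hbp x)
  rw [CStarAlgebra.norm_le_iff_le_algebraMap _ μ.coe_nonneg (hmid _ _ ha)] at h
  have h1 : a ≤ μ • b ^ (-1 : ℝ) := by
    have := conjugate_le_conjugate_of_nonneg h (hbp (-(1 / 2)))
    have e1 : b ^ (-(1 / 2) : ℝ) * (b ^ (1 / 2 : ℝ) * a * b ^ (1 / 2 : ℝ)) * b ^ (-(1 / 2) : ℝ)
        = a := by
      calc _ = (b ^ (-(1 / 2) : ℝ) * b ^ (1 / 2 : ℝ)) * a *
            (b ^ (1 / 2 : ℝ) * b ^ (-(1 / 2) : ℝ)) := by simp only [mul_assoc]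
        _ = a := by rw [CFC.rpow_neg_mul_rpow _ hb, CFC.rpow_mul_rpow_neg _ hb]; simp
    have e2 : b ^ (-(1 / 2) : ℝ) * algebraMap ℝ A μ * b ^ (-(1 / 2) : ℝ) = μ • b ^ (-1 : ℝ) := by
      rw [← Algebra.commutes, mul_assoc, ← CFC.rpow_add hb.isUnit, ← Algebra.smul_def,
        NNReal.smul_def]
      norm_num
    rwa [e1, e2] at this
  have h2 := CFC.rpow_le_rpow ⟨hs₀.le, hs₁⟩ h1
  rw [CFC.smul_rpow _ _ (hbp _) hs₀, CFC.rpow_rpow _ _ _ (by norm_num) hb, neg_one_mul] at h2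
  rw [← NNReal.coe_rpow, CStarAlgebra.norm_le_iff_le_algebraMap _ (μ ^ s).coe_nonneg (hmid _ _ CFC.rpow_nonneg)]
  have h3 := conjugate_le_conjugate_of_nonneg h2 (hbp (s / 2))
  have e : b ^ (s / 2) * (μ ^ s • b ^ (-s)) * b ^ (s / 2) = algebraMap ℝ A ↑(μ ^ s) := by
    rw [mul_smul_comm, smul_mul_assoc, ← CFC.rpow_add hb.isUnit, ← CFC.rpow_add hb.isUnit,
      Algebra.algebraMap_eq_smul_one, NNReal.smul_def]
    congr 1
    rw [← CFC.rpow_zero b hb.nonneg]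
    congr 1
    ring
  rwa [e] at h3

/-- **Cordes inequality** in a C⋆-algebra. -/
theorem norm_rpow_half_mul_rpow_half_le {a b : A} (ha : 0 ≤ a) (hb : 0 ≤ b) {s : ℝ} (hs₀ : 0 < s)
    (hs₁ : s ≤ 1) :
    ‖a ^ (s / 2) * b ^ (s / 2)‖ ≤ ‖a ^ (1 / 2 : ℝ) * b ^ (1 / 2 : ℝ)‖ ^ s := by
  have hap : ∀ x : ℝ, 0 ≤ a ^ x := fun x => CFC.rpow_nonneg
  set ν := ‖a ^ (1 / 2 : ℝ) * b ^ (1 / 2 : ℝ)‖ with hν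
  have hν' : ‖a ^ (1 / 2 : ℝ) * b * a ^ (1 / 2 : ℝ)‖ = ν ^ 2 := by
    rw [hν, norm_rpow_mul_rpow_comm, norm_rpow_mul_rpow_sq hb zero_le_one _, CFC.rpow_one b hb]
  have key : ∀ ε : ℝ, 0 < ε → ‖a ^ (s / 2) * b ^ (s / 2)‖ ^ 2 ≤ (ν ^ 2 + ε * ‖a‖) ^ s := by
    intro ε hε
    set c := b + algebraMap ℝ A ε with hc
    have hbc : b ≤ c := le_add_of_nonneg_right (algebraMap_nonneg A hε.le)
    have hc0 : IsStrictlyPositive c := by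
      refine IsStrictlyPositive.nonneg_add hb ?_
      exact isStrictlyPositive_algebraMap hε
    have hν2 : ‖c ^ (1 / 2 : ℝ) * a * c ^ (1 / 2 : ℝ)‖ ≤ ν ^ 2 + ε * ‖a‖ := by
      have := norm_rpow_mul_rpow_sq (b := c) ha zero_le_one (1 / 2)
      rw [CFC.rpow_one a ha] at this
      rw [← this, norm_rpow_mul_rpow_comm, norm_rpow_mul_rpow_sq hc0.nonneg zero_le_one _,
        CFC.rpow_one c hc0.nonneg, hc, mul_add, add_mul]
      refine (norm_add_le _ _).trans ?_
      rw [hν', ← Algebra.commutes, mul_assoc, CFC.rpow_half_mul_rpow_half ha zero_le_one,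
        CFC.rpow_one a ha, ← Algebra.smul_def, norm_smul, Real.norm_of_nonneg hε.le]
    refine le_trans ?_ (norm_rpow_mul_rpow_sq_le_of_isStrictlyPositive ha hc0 hs₀ hs₁
      (by positivity) hν2)
    rw [← norm_rpow_mul_rpow_sq ha hs₀.le _, norm_rpow_mul_rpow_comm,
      norm_rpow_mul_rpow_comm (a := a) (b := c), norm_rpow_mul_rpow_sq hb hs₀.le _,
      norm_rpow_mul_rpow_sq hc0.nonneg hs₀.le _]
    refine CStarAlgebra.norm_le_norm_of_nonneg_of_le ?_ ?_
    · simpa using conjugate_le_conjugate_of_nonneg (CFC.rpow_nonneg (a := b) (y := s)) (hap _)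
    · exact conjugate_le_conjugate_of_nonneg (CFC.rpow_le_rpow ⟨hs₀.le, hs₁⟩ hbc) (hap _)
  have hlim : Filter.Tendsto (fun ε : ℝ => (ν ^ 2 + ε * ‖a‖) ^ s) (nhdsWithin 0 (Set.Ioi 0))
      (nhds ((ν ^ 2 + 0 * ‖a‖) ^ s)) := by
    refine Filter.Tendsto.mono_left (Continuous.tendsto ?_ 0) nhdsWithin_le_nhds
    exact Continuous.rpow_const (by fun_prop) fun _ => Or.inr hs₀.le
  have h := ge_of_tendsto hlim (Filter.eventually_of_mem self_mem_nhdsWithin key)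
  rw [zero_mul, add_zero, ← Real.rpow_natCast_mul (norm_nonneg _), mul_comm,
    Real.rpow_mul_natCast (norm_nonneg _)] at h
  exact (sq_le_sq₀ (norm_nonneg _) (by positivity)).1 h

theorem norm_rpow_conj_le_norm_rpow_conj_rpow {a b : A} (ha : 0 ≤ a) (hb : 0 ≤ b) {r s : ℝ}
    (hs₀ : 0 < s) (hs₁ : s ≤ 1) (hrs : r * s = 1) :
    ‖b ^ (s / 2) * a * b ^ (s / 2)‖ ≤ ‖a ^ (r / 2) * b * a ^ (r / 2)‖ ^ s := by
  have hr : 0 < r := by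
    by_contra! h
    nlinarith
  have h := norm_rpow_half_mul_rpow_half_le (CFC.rpow_nonneg (a := a) (y := r)) hb hs₀ hs₁
  rw [CFC.rpow_rpow_of_exponent_nonneg a r (s / 2) hr.le (by positivity) ha,
    CFC.rpow_rpow_of_exponent_nonneg a r (1 / 2) hr.le (by positivity) ha,
    show r * (s / 2) = 1 / 2 by linarith, mul_one_div] at h
  have h1 := norm_rpow_mul_rpow_sq (b := b) ha zero_le_one (s / 2)
  have h2 := norm_rpow_mul_rpow_sq (b := a) hb zero_le_one (r / 2)
  rw [CFC.rpow_one _ ha] at h1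
  rw [CFC.rpow_one _ hb, norm_rpow_mul_rpow_comm] at h2
  rw [← h1, ← h2, ← Real.rpow_natCast_mul (norm_nonneg _), mul_comm,
    Real.rpow_mul_natCast (norm_nonneg _)]
  exact pow_le_pow_left₀ (norm_nonneg _) h 2

end CStar

section Majorization
open Finset

theorem Finset.prod_le_prod_range_card_of_antitone {y : ℕ → ℝ} (hy : Antitone y) (hy₀ : ∀ i, 0 ≤ y i)
    (T : Finset ℕ) : ∏ i ∈ T, y i ≤ ∏ i ∈ range #T, y i := by
  induction T using Finset.induction_on_max with
  | empty => simp
  | insert M T hM ih =>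
    have hnot : M ∉ T := fun h => (hM M h).false
    rw [prod_insert hnot, card_insert_of_notMem hnot, prod_range_succ, mul_comm]
    have hcard : #T ≤ M := by
      simpa using card_le_card (fun i hi => mem_range.2 (hM i hi) : T ⊆ range M)
    exact mul_le_mul ih (hy hcard) (hy₀ _) (prod_nonneg fun i _ => hy₀ i)

theorem Finset.sum_range_mul_nonneg_of_antitone {a d : ℕ → ℝ} (ha : Antitone a) (ha₀ : ∀ i, 0 ≤ a i)
    {m : ℕ} (hd : ∀ k ≤ m, 0 ≤ ∑ i ∈ range k, d i) : 0 ≤ ∑ i ∈ range m, a i * d i := by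
  have key : ∀ k ≤ m, a k * ∑ i ∈ range k, d i ≤ ∑ i ∈ range k, a i * d i := by
    intro k
    induction k with
    | zero => simp
    | succ k ih =>
      intro hk
      have h1 := ih (by omega)
      have h2 := mul_le_mul_of_nonneg_right (ha k.le_succ) (hd _ hk)
      rw [sum_range_succ] at h2 ⊢
      rw [sum_range_succ]
      simp only [Nat.succ_eq_add_one] at h2
      linarith
  exact (mul_nonneg (ha₀ m) (hd m le_rfl)).trans (key m le_rfl)

theorem Finset.sum_range_le_sum_range_of_prod_le {a b : ℕ → ℝ} (ha : Antitone a)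
    (ha₀ : ∀ i, 0 ≤ a i) (hb₀ : ∀ i, 0 ≤ b i) {m : ℕ}
    (h : ∀ k ≤ m, ∏ i ∈ range k, a i ≤ ∏ i ∈ range k, b i) :
    ∑ i ∈ range m, a i ≤ ∑ i ∈ range m, b i := by
  induction m with
  | zero => simp
  | succ m ih =>
    rcases (ha₀ m).eq_or_lt with h0 | hpos
    · rw [sum_range_succ, sum_range_succ, ← h0]
      exact add_le_add (ih fun k hk => h k (by omega)) (hb₀ m)
    have hapos : ∀ i ∈ range (m + 1), 0 < a i := fun i hi =>
      hpos.trans_le (ha (by simpa [Nat.lt_succ_iff] using hi))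
    have hbpos : ∀ i ∈ range (m + 1), 0 < b i := by
      have := (prod_pos hapos).trans_le (h (m + 1) le_rfl)
      intro i hi
      exact (hb₀ i).lt_of_ne' (prod_ne_zero_iff.1 this.ne' i hi)
    have hlog := sum_range_mul_nonneg_of_antitone (m := m + 1)
      (d := fun i => Real.log (b i) - Real.log (a i)) ha ha₀ fun k hk => by
        have hsub : range k ⊆ range (m + 1) := range_subset_range.2 hk
        rw [sum_sub_distrib, ← Real.log_prod fun i hi => (hbpos i (hsub hi)).ne',
          ← Real.log_prod fun i hi => (hapos i (hsub hi)).ne', sub_nonneg]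
        exact Real.log_le_log (prod_pos fun i hi => hapos i (hsub hi)) (h k hk)
    have hle : ∑ i ∈ range (m + 1), a i * (Real.log (b i) - Real.log (a i)) ≤
        ∑ i ∈ range (m + 1), (b i - a i) := by
      refine sum_le_sum fun i hi => ?_
      have hai := hapos i hi
      have hbi := hbpos i hi
      rw [← Real.log_div hbi.ne' hai.ne']
      calc a i * Real.log (b i / a i) ≤ a i * (b i / a i - 1) :=
            mul_le_mul_of_nonneg_left (Real.log_le_sub_one_of_pos (div_pos hbi hai)) hai.le
        _ = b i - a i := by field_simp
    rw [sum_sub_distrib] at hle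
    linarith

theorem exists_antitone_extension {n : ℕ} (x : Fin n → ℝ) (hx : ∀ i, 0 ≤ x i) :
    ∃ (e : Fin n ↪ ℕ) (y : ℕ → ℝ), Antitone y ∧ (∀ i, 0 ≤ y i) ∧ (∀ i, y (e i) = x i) ∧
      univ.map e = range n := by
  let σ := Tuple.sort (OrderDual.toDual ∘ x)
  have hσ : Antitone (x ∘ σ) := fun i j hij => Tuple.monotone_sort (OrderDual.toDual ∘ x) hij
  refine ⟨σ.symm.toEmbedding.trans Fin.valEmbedding,
    fun i => if h : i < n then x (σ ⟨i, h⟩) else 0, ?_, ?_, ?_, ?_⟩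
  · intro i j hij
    by_cases hj : j < n
    · have hi : i < n := by omega
      simpa [hi, hj] using hσ (show (⟨i, hi⟩ : Fin n) ≤ ⟨j, hj⟩ from hij)
    · by_cases hi : i < n <;> simp [hi, hj, hx]
  · intro i
    by_cases hi : i < n <;> simp [hi, hx]
  · simp
  · rw [← Finset.map_map, Finset.map_univ_equiv]
    ext i
    simp

/-- Log-majorization implies that the sums compare. -/
theorem sum_le_sum_of_forall_exists_prod_le {n : ℕ} {x y : Fin n → ℝ} (hx : ∀ i, 0 ≤ x i)
    (hy : ∀ i, 0 ≤ y i)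
    (h : ∀ S : Finset (Fin n), ∃ T : Finset (Fin n), #T = #S ∧ ∏ i ∈ S, x i ≤ ∏ i ∈ T, y i) :
    ∑ i, x i ≤ ∑ i, y i := by
  obtain ⟨e, X, hX, hX₀, hXe, he⟩ := exists_antitone_extension x hx
  obtain ⟨f, Y, hY, hY₀, hYf, hf⟩ := exists_antitone_extension y hy
  have hsum := sum_range_le_sum_range_of_prod_le (m := n) hX hX₀ hY₀ fun k hk => by
    obtain ⟨S, -, hS⟩ := subset_map_iff.1 ((range_subset_range.2 hk).trans he.ge)
    obtain ⟨T, hTS, hT⟩ := h S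
    have hk' : #T = k := by rw [hTS, ← card_map e, ← hS, card_range]
    calc ∏ i ∈ range k, X i = ∏ i ∈ S, x i := by simp [hS, prod_map, hXe]
      _ ≤ ∏ i ∈ T, y i := hT
      _ = ∏ i ∈ T.map f, Y i := by simp [prod_map, hYf]
      _ ≤ ∏ i ∈ range k, Y i := by
        simpa [hk'] using prod_le_prod_range_card_of_antitone hY hY₀ (T.map f)
  have hx' : ∑ i, x i = ∑ i ∈ range n, X i := by simp [← he, hXe]
  have hy' : ∑ i, y i = ∑ i ∈ range n, Y i := by simp [← hf, hYf]
  rwa [hx', hy']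

end Majorization

section Compound

namespace Matrix
variable {n k : ℕ}

/-- The `k`-th compound matrix, whose entries are the `k × k` minors. -/
noncomputable def compound (k : ℕ) (A : Matrix (Fin n) (Fin n) ℂ) :
    Matrix (Set.powersetCard (Fin n) k) (Set.powersetCard (Fin n) k) ℂ :=
  of fun s t => (A.submatrix (Set.powersetCard.ofFinEmbEquiv.symm s)
    (Set.powersetCard.ofFinEmbEquiv.symm t)).det

theorem compound_eq_toMatrix_exteriorPower_map (A : Matrix (Fin n) (Fin n) ℂ) :
    compound k A = LinearMap.toMatrix ((Pi.basisFun ℂ (Fin n)).exteriorPower k)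
      ((Pi.basisFun ℂ (Fin n)).exteriorPower k) (exteriorPower.map k (toLin' A)) := by
  ext s t
  rw [LinearMap.toMatrix_apply, exteriorPower.basis_repr_apply, exteriorPower.basis_apply,
    exteriorPower.map_apply_ιMulti_family, exteriorPower.ιMulti_family,
    exteriorPower.ιMultiDual_apply_ιMulti, compound, of_apply, ← det_transpose]
  congr 1
  ext i j
  simp

theorem compound_mul (A B : Matrix (Fin n) (Fin n) ℂ) :
    compound k (A * B) = compound k A * compound k B := by
  simp only [compound_eq_toMatrix_exteriorPower_map, toLin'_mul, exteriorPower.map_comp]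
  exact LinearMap.toMatrix_comp _ _ _ _ _

theorem compound_conjTranspose (A : Matrix (Fin n) (Fin n) ℂ) :
    compound k Aᴴ = (compound k A)ᴴ := by
  ext s t
  simp only [compound, of_apply, conjTranspose_apply, ← det_conjTranspose, conjTranspose_submatrix]

theorem compound_diagonal (d : Fin n → ℂ) :
    compound k (diagonal d) = diagonal fun s => ∏ i ∈ s.val, d i := by
  ext s t
  rw [compound, of_apply]
  by_cases hst : s = t
  · subst hst
    rw [diagonal_apply_eq, submatrix_diagonal _ _ (Set.powersetCard.ofFinEmbEquiv.symm s).injective, det_diagonal]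
    simp only [Function.comp_apply, Set.powersetCard.ofFinEmbEquiv_symm_apply]
    refine Eq.trans ?_ (congrArg (fun u => ∏ i ∈ u, d i)
      (Finset.map_orderEmbOfFin_univ s.val s.prop))
    simp
  · rw [diagonal_apply_ne _ hst]
    obtain ⟨i, his, hit⟩ := (Set.powersetCard.exists_mem_notMem_iff_ne s t).mp hst
    obtain ⟨l, rfl⟩ := (Set.powersetCard.mem_range_ofFinEmbEquiv_symm_iff_mem s i).mpr his
    refine det_eq_zero_of_row_eq_zero l fun j => ?_
    rw [submatrix_apply, diagonal_apply_ne]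
    intro h
    apply hit
    rw [h]
    exact (Set.powersetCard.mem_range_ofFinEmbEquiv_symm_iff_mem t _).mp ⟨j, rfl⟩

theorem compound_one : compound k (1 : Matrix (Fin n) (Fin n) ℂ) = 1 := by
  rw [← diagonal_one, compound_diagonal]
  simp

theorem compound_mem_unitaryGroup {U : Matrix (Fin n) (Fin n) ℂ} (hU : U ∈ unitaryGroup (Fin n) ℂ) :
    compound k U ∈ unitaryGroup (Set.powersetCard (Fin n) k) ℂ := by
  rw [mem_unitaryGroup_iff, star_eq_conjTranspose] at hU ⊢
  rw [← compound_conjTranspose, ← compound_mul, hU, compound_one]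

end Matrix
end Compound

section Rpow
open scoped Matrix.Norms.L2Operator MatrixOrder

namespace Matrix
variable {ι : Type*} [Fintype ι] [DecidableEq ι]

theorem aeval_unitary_conj_diagonal (U : unitaryGroup ι ℂ) (d : ι → ℝ) (q : Polynomial ℝ) :
    Polynomial.aeval ((U : Matrix ι ι ℂ) * diagonal (fun i => (d i : ℂ)) * star (U : Matrix ι ι ℂ)) q =
      (U : Matrix ι ι ℂ) * diagonal (fun i => ((q.eval (d i) : ℝ) : ℂ)) * star (U : Matrix ι ι ℂ) := by
  let φ : (ι → ℝ) →ₐ[ℝ] Matrix ι ι ℂ :=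
    ((Unitary.conjStarAlgAut ℝ (Matrix ι ι ℂ) U : Matrix ι ι ℂ →⋆ₐ[ℝ] Matrix ι ι ℂ).toAlgHom).comp
      ((diagonalAlgHom ℝ).comp (Complex.ofRealAm.compLeft ι))
  have h := Polynomial.aeval_algHom_apply φ d q
  rw [Polynomial.aeval_pi_apply] at h
  exact h

theorem cfc_unitary_conj_diagonal (U : unitaryGroup ι ℂ) (d : ι → ℝ) (f : ℝ → ℝ) :
    cfc f ((U : Matrix ι ι ℂ) * diagonal (fun i => (d i : ℂ)) * star (U : Matrix ι ι ℂ)) =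
      (U : Matrix ι ι ℂ) * diagonal (fun i => ((f (d i) : ℝ) : ℂ)) * star (U : Matrix ι ι ℂ) := by
  set A := (U : Matrix ι ι ℂ) * diagonal (fun i => (d i : ℂ)) * star (U : Matrix ι ι ℂ) with hA
  have hsa : IsSelfAdjoint A := by
    simp [hA, IsSelfAdjoint, star_eq_conjTranspose, mul_assoc, diagonal_conjTranspose, Pi.star_def]
  have hfin : (spectrum ℝ A ∪ Set.range d).Finite := finite_real_spectrum.union (Set.finite_range d)
  let q := Lagrange.interpolate hfin.toFinset id f
  have hq : ∀ x ∈ spectrum ℝ A ∪ Set.range d, q.eval x = f x := fun x hx =>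
    Lagrange.eval_interpolate_at_node (v := id) f Function.injective_id.injOn
      (hfin.mem_toFinset.2 hx)
  rw [← cfc_congr (f := fun x => q.eval x) fun x hx => hq x (Or.inl hx), cfc_polynomial q A hsa, hA,
    aeval_unitary_conj_diagonal]
  simp only [hq _ (Or.inr ⟨_, rfl⟩)]

theorem unitary_conj_diagonal_nonneg (U : unitaryGroup ι ℂ) {d : ι → ℝ} (hd : ∀ i, 0 ≤ d i) :
    0 ≤ (U : Matrix ι ι ℂ) * diagonal (fun i => (d i : ℂ)) * star (U : Matrix ι ι ℂ) := by
  rw [nonneg_iff_posSemidef]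
  exact (PosSemidef.diagonal fun i => by simpa using hd i).mul_mul_conjTranspose_same _

theorem rpow_unitary_conj_diagonal (U : unitaryGroup ι ℂ) {d : ι → ℝ} (hd : ∀ i, 0 ≤ d i) (t : ℝ) :
    ((U : Matrix ι ι ℂ) * diagonal (fun i => (d i : ℂ)) * star (U : Matrix ι ι ℂ)) ^ t =
      (U : Matrix ι ι ℂ) * diagonal (fun i => ((d i ^ t : ℝ) : ℂ)) * star (U : Matrix ι ι ℂ) := by
  rw [CFC.rpow_eq_cfc_real (unitary_conj_diagonal_nonneg U hd), cfc_unitary_conj_diagonal]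

theorem norm_unitary_conj_diagonal (U : unitaryGroup ι ℂ) (d : ι → ℝ) :
    ‖(U : Matrix ι ι ℂ) * diagonal (fun i => (d i : ℂ)) * star (U : Matrix ι ι ℂ)‖ = ‖d‖ := by
  rw [← Unitary.coe_star, CStarRing.norm_mul_coe_unitary, CStarRing.norm_coe_unitary_mul,
    l2_opNorm_diagonal]
  simp [Pi.norm_def]

theorem IsHermitian.eq_unitary_conj_diagonal {A : Matrix ι ι ℂ} (hA : A.IsHermitian) :
    A = (hA.eigenvectorUnitary : Matrix ι ι ℂ) * diagonal (fun i => (hA.eigenvalues i : ℂ)) *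
      star (hA.eigenvectorUnitary : Matrix ι ι ℂ) :=
  hA.spectral_theorem

theorem PosSemidef.mpow_eq_rpow {A : Matrix ι ι ℂ} (hA : A.PosSemidef) (t : ℝ) :
    mpow A t = A ^ t := by
  conv_rhs => rw [hA.isHermitian.eq_unitary_conj_diagonal]
  rw [rpow_unitary_conj_diagonal _ hA.eigenvalues_nonneg, mpow, dif_pos hA.isHermitian]

theorem IsHermitian.re_trace_mpow {A : Matrix ι ι ℂ} (hA : A.IsHermitian) (t : ℝ) :
    (mpow A t).trace.re = ∑ i, hA.eigenvalues i ^ t := by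
  rw [mpow, dif_pos hA, trace_mul_comm, ← mul_assoc, Unitary.coe_star_mul_self, one_mul,
    trace_diagonal]
  simp

theorem exists_compound_unitary_conj_diagonal {n : ℕ} (k : ℕ) (U : unitaryGroup (Fin n) ℂ) :
    ∃ V : unitaryGroup (Set.powersetCard (Fin n) k) ℂ, ∀ d : Fin n → ℝ,
      compound k ((U : Matrix (Fin n) (Fin n) ℂ) * diagonal (fun i => (d i : ℂ)) *
        star (U : Matrix (Fin n) (Fin n) ℂ)) =
      (V : Matrix (Set.powersetCard (Fin n) k) (Set.powersetCard (Fin n) k) ℂ) *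
        diagonal (fun s : Set.powersetCard (Fin n) k => ((∏ i ∈ s.val, d i : ℝ) : ℂ)) *
        star (V : Matrix (Set.powersetCard (Fin n) k) (Set.powersetCard (Fin n) k) ℂ) := by
  refine ⟨⟨_, compound_mem_unitaryGroup U.2⟩, fun d => ?_⟩
  simp only [compound_mul, compound_diagonal, star_eq_conjTranspose, compound_conjTranspose,
    Complex.ofReal_prod]

theorem PosSemidef.compound_nonneg {n : ℕ} (k : ℕ) {A : Matrix (Fin n) (Fin n) ℂ}
    (hA : A.PosSemidef) : 0 ≤ compound k A := by
  obtain ⟨V, hV⟩ := exists_compound_unitary_conj_diagonal k hA.isHermitian.eigenvectorUnitary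
  rw [hA.isHermitian.eq_unitary_conj_diagonal, hV]
  exact unitary_conj_diagonal_nonneg V fun s => Finset.prod_nonneg fun i _ => hA.eigenvalues_nonneg i

theorem PosSemidef.compound_rpow {n : ℕ} (k : ℕ) {A : Matrix (Fin n) (Fin n) ℂ}
    (hA : A.PosSemidef) (t : ℝ) : compound k (A ^ t) = compound k A ^ t := by
  obtain ⟨V, hV⟩ := exists_compound_unitary_conj_diagonal k hA.isHermitian.eigenvectorUnitary
  rw [hA.isHermitian.eq_unitary_conj_diagonal, rpow_unitary_conj_diagonal _ hA.eigenvalues_nonneg,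
    hV, hV, rpow_unitary_conj_diagonal _ fun s => Finset.prod_nonneg fun i _ =>
      hA.eigenvalues_nonneg i]
  simp only [Real.finsetProd_rpow _ _ fun i _ => hA.eigenvalues_nonneg i]

theorem IsHermitian.norm_compound {n : ℕ} (k : ℕ) {A : Matrix (Fin n) (Fin n) ℂ}
    (hA : A.IsHermitian) :
    ‖compound k A‖ = ‖fun s : Set.powersetCard (Fin n) k => ∏ i ∈ s.val, hA.eigenvalues i‖ := by
  obtain ⟨V, hV⟩ := exists_compound_unitary_conj_diagonal k hA.eigenvectorUnitary
  conv_lhs => rw [hA.eq_unitary_conj_diagonal]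
  rw [hV, norm_unitary_conj_diagonal]

theorem PosSemidef.rpow_conj {A B : Matrix ι ι ℂ} (hA : A.PosSemidef) (t : ℝ) :
    (B ^ t * A * B ^ t).PosSemidef := by
  rw [← nonneg_iff_posSemidef] at hA ⊢
  simpa using conjugate_le_conjugate_of_nonneg hA (CFC.rpow_nonneg (a := B) (y := t))

/-- Log-majorization form of the Araki–Lieb–Thirring inequality. -/
theorem exists_prod_eigenvalues_rpow_conj_le {n : ℕ} {A B : Matrix (Fin n) (Fin n) ℂ}
    (hA : A.PosSemidef) (hB : B.PosSemidef) {r s : ℝ} (hs₀ : 0 < s) (hs₁ : s ≤ 1)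
    (hrs : r * s = 1) (S : Finset (Fin n)) :
    ∃ T : Finset (Fin n), T.card = S.card ∧
      ∏ i ∈ S, (hA.rpow_conj (B := B) (s / 2)).isHermitian.eigenvalues i ≤
        (∏ i ∈ T, (hB.rpow_conj (B := A) (r / 2)).isHermitian.eigenvalues i) ^ s := by
  set hX := hA.rpow_conj (B := B) (s / 2)
  set hY := hB.rpow_conj (B := A) (r / 2)
  set k := S.card with hk
  have hnorm := norm_rpow_conj_le_norm_rpow_conj_rpow (hA.compound_nonneg k) (hB.compound_nonneg k)
    hs₀ hs₁ hrs
  rw [← hA.compound_rpow, ← hB.compound_rpow, ← compound_mul, ← compound_mul, ← compound_mul,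
    ← compound_mul, hX.isHermitian.norm_compound, hY.isHermitian.norm_compound] at hnorm
  have : Nonempty (Set.powersetCard (Fin n) k) := ⟨⟨S, hk.symm⟩⟩
  obtain ⟨T, hT⟩ := Finite.exists_max fun s : Set.powersetCard (Fin n) k =>
    ∏ i ∈ s.val, hY.isHermitian.eigenvalues i
  have hprod : ∀ T : Finset (Fin n), 0 ≤ ∏ i ∈ T, hY.isHermitian.eigenvalues i := fun T =>
    Finset.prod_nonneg fun i _ => hY.eigenvalues_nonneg i
  refine ⟨T.val, T.prop, ?_⟩
  calc ∏ i ∈ S, hX.isHermitian.eigenvalues i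
      ≤ ‖fun s : Set.powersetCard (Fin n) k => ∏ i ∈ s.val, hX.isHermitian.eigenvalues i‖ :=
        (Real.le_norm_self _).trans (norm_le_pi_norm
          (fun s : Set.powersetCard (Fin n) k => ∏ i ∈ s.val, hX.isHermitian.eigenvalues i)
          ⟨S, hk.symm⟩)
    _ ≤ _ := hnorm
    _ ≤ _ := by
      refine Real.rpow_le_rpow (norm_nonneg _) ?_ hs₀.le
      refine (pi_norm_le_iff_of_nonneg (hprod _)).2 fun s => ?_
      rw [Real.norm_of_nonneg (hprod _)]
      exact hT s

end Matrix

theorem aFid_eq_sum {ι : Type*} [Fintype ι] [DecidableEq ι] {ρ σ : Matrix ι ι ℂ}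
    (hρ : ρ.PosSemidef) (hσ : σ.PosSemidef) {α t : ℝ} (ht : (1 - α) / α = t) :
    aFid α ρ σ = ∑ i, (hρ.rpow_conj (B := σ) (t / 2)).isHermitian.eigenvalues i ^ α := by
  rw [aFid, hσ.mpow_eq_rpow, mul_comm 2 α, ← div_div, ht, IsHermitian.re_trace_mpow]

end Rpow

/-- for `α ∈ [1/2, 1)` one has `F_α(ρ₁, ρ₂) ≤ F_{1−α}(ρ₂, ρ₁)`
(a consequence of the Araki–Lieb–Thirring inequality). -/
theorem stmt17 {n : ℕ} (α : ℝ) (hα : (1 : ℝ) / 2 ≤ α) (hα' : α < 1)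
    (ρ₁ ρ₂ : Matrix (Fin n) (Fin n) ℂ) (hρ₁ : IsDensity ρ₁) (hρ₂ : IsDensity ρ₂) :
    aFid α ρ₁ ρ₂ ≤ aFid (1 - α) ρ₂ ρ₁ := by
  have hα₀ : 0 < α := by linarith
  have hβ₀ : 0 < 1 - α := by linarith
  rw [aFid_eq_sum hρ₁.1 hρ₂.1 rfl,
    aFid_eq_sum hρ₂.1 hρ₁.1 (α := 1 - α) (t := α / (1 - α)) (by rw [sub_sub_cancel])]
  set hX := hρ₁.1.rpow_conj (B := ρ₂) ((1 - α) / α / 2)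
  set hY := hρ₂.1.rpow_conj (B := ρ₁) (α / (1 - α) / 2)
  refine sum_le_sum_of_forall_exists_prod_le
    (fun i => Real.rpow_nonneg (hX.eigenvalues_nonneg i) _)
    (fun i => Real.rpow_nonneg (hY.eigenvalues_nonneg i) _) fun S => ?_
  obtain ⟨T, hTS, hT⟩ := exists_prod_eigenvalues_rpow_conj_le hρ₁.1 hρ₂.1 (r := α / (1 - α))
    (s := (1 - α) / α) (div_pos hβ₀ hα₀) ((div_le_one hα₀).2 (by linarith))
    (by field_simp) S
  refine ⟨T, hTS, ?_⟩
  have hY₀ := Finset.prod_nonneg fun i (_ : i ∈ T) => hY.eigenvalues_nonneg i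
  rw [Real.finsetProd_rpow _ _ fun i _ => hX.eigenvalues_nonneg i,
    Real.finsetProd_rpow _ _ fun i _ => hY.eigenvalues_nonneg i]
  refine (Real.rpow_le_rpow (Finset.prod_nonneg fun i _ => hX.eigenvalues_nonneg i) hT
    hα₀.le).trans_eq ?_
  rw [← Real.rpow_mul hY₀, div_mul_cancel₀ _ hα₀.ne']
end
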